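/- Lower bound in Hansel's theorem: for every natural number n, every correct adaptive query strategy (decision tree) that identifies an unknown monotone Boolean function f : (Fin n → Bool) → Bool by querying values f(v) must, for some monotone Boolean function, use at least C(n, ⌊n/2⌋) + C(n, ⌊n/2⌋ + 1) queries; i.e., the worst-case query count of every correct strategy is at least C(n, ⌊n/2⌋) + C(n, ⌊n/2⌋ + 1). -/

import Mathlib

/-- An adaptive query strategy (decision tree): each internal node queries
the value of the unknown function at a vector, each leaf outputs a function. -/
inductive Strategy (n : ℕ) : Type where
  | leaf : ((Fin n → Bool) → Bool) → Strategy n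
  | node : (Fin n → Bool) → Strategy n → Strategy n → Strategy n

/-- Run a strategy against a function `f`: follow the branch determined by
`f`'s answers, returning the leaf label together with the number of queries used. -/
def Strategy.run {n : ℕ} : Strategy n → ((Fin n → Bool) → Bool) → ((Fin n → Bool) → Bool) × ℕ
  | .leaf g, _ => (g, 0)
  | .node v s₀ s₁, f =>
      let r := if f v then s₁.run f else s₀.run f
      (r.1, r.2 + 1)

/-- A Boolean function is monotone if larger inputs (pointwise, `false < true`)
give larger outputs. -/
def MonotoneBool {n : ℕ} (f : (Fin n → Bool) → Bool) : Prop :=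
  ∀ v w : Fin n → Bool, (∀ i, w i = true → v i = true) → f w = true → f v = true

/-- A strategy is correct if on every monotone function it reaches a leaf
labeled by that very function. -/
def Strategy.Correct {n : ℕ} (s : Strategy n) : Prop :=
  ∀ f : (Fin n → Bool) → Bool, MonotoneBool f → (s.run f).1 = f

/-- The set of vectors queried by a strategy along the branch followed by `f`. -/
def Strategy.queried {n : ℕ} :
    Strategy n → ((Fin n → Bool) → Bool) → Finset (Fin n → Bool)
  | .leaf _, _ => ∅
  | .node v s₀ s₁, f => insert v (if f v then s₁.queried f else s₀.queried f)

theorem Strategy.card_queried_le {n : ℕ} (s : Strategy n) (f : (Fin n → Bool) → Bool) :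
    (s.queried f).card ≤ (s.run f).2 := by
  induction s with
  | leaf g => simp [queried, run]
  | node v s₀ s₁ ih₀ ih₁ =>
    simp only [queried, run]
    refine (Finset.card_insert_le _ _).trans (Nat.add_le_add_right ?_ 1)
    split_ifs <;> assumption

theorem Strategy.run_congr {n : ℕ} (s : Strategy n) {f g : (Fin n → Bool) → Bool}
    (h : ∀ v ∈ s.queried f, f v = g v) : s.run f = s.run g := by
  induction s with
  | leaf _ => rfl
  | node v s₀ s₁ ih₀ ih₁ =>
    simp only [queried, Finset.forall_mem_insert] at h
    obtain ⟨hv, h⟩ := h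
    simp only [run, ← hv]
    split_ifs at h ⊢
    · rw [ih₁ h]
    · rw [ih₀ h]

/-- A correct strategy must query every vector at which flipping the value of `f`
preserves monotonicity. -/
theorem Strategy.Correct.mem_queried {n : ℕ} {s : Strategy n} (hs : s.Correct)
    {f : (Fin n → Bool) → Bool} (hf : MonotoneBool f) {v : Fin n → Bool}
    (hv : MonotoneBool (Function.update f v (!f v))) : v ∈ s.queried f := by
  by_contra hmem
  have hrun : s.run f = s.run (Function.update f v (!f v)) :=
    s.run_congr fun w hw => by
      rw [Function.update_of_ne (ne_of_mem_of_not_mem hw hmem)]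
  have heq : f = Function.update f v (!f v) :=
    (hs f hf).symm.trans ((congrArg Prod.fst hrun).trans (hs _ hv))
  have := congrFun heq v
  simp at this

/-- The number of coordinates at which a Boolean vector is true. -/
def weight {n : ℕ} (v : Fin n → Bool) : ℕ := (Finset.univ.filter fun i => v i = true).card

theorem weight_le_weight {n : ℕ} {v w : Fin n → Bool} (h : ∀ i, w i = true → v i = true) :
    weight w ≤ weight v :=
  Finset.card_le_card fun i hi => by simpa using h i (by simpa using hi)

theorem eq_of_weight_le {n : ℕ} {v w : Fin n → Bool} (h : ∀ i, w i = true → v i = true)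
    (hle : weight v ≤ weight w) : w = v := by
  have hsub : (Finset.univ.filter fun i => w i = true) ⊆
      Finset.univ.filter fun i => v i = true :=
    fun i hi => by simpa using h i (by simpa using hi)
  have := Finset.eq_of_subset_of_card_le hsub hle
  ext i
  have hi := Finset.ext_iff.mp this i
  simp only [Finset.mem_filter_univ] at hi
  exact Bool.eq_iff_iff.mpr hi

theorem choose_eq_card_weight (n k : ℕ) :
    n.choose k = (Finset.univ.filter fun v : Fin n → Bool => weight v = k).card := by
  have h : (Finset.powersetCard k (Finset.univ : Finset (Fin n))).card = n.choose k := by simp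
  rw [← h]
  refine Finset.card_bij' (fun s _ i => decide (i ∈ s))
    (fun v _ => Finset.univ.filter fun i => v i = true) ?_ ?_ ?_ ?_
  · intro s hs
    rw [Finset.mem_filter_univ]
    simpa [weight] using hs
  · intro v hv
    rw [Finset.mem_filter_univ] at hv
    simpa [weight] using hv
  · simp
  · simp

theorem monotoneBool_threshold (n k : ℕ) :
    MonotoneBool fun v : Fin n → Bool => decide (k ≤ weight v) := fun v w h hw => by
  simp only [decide_eq_true_eq] at hw ⊢
  exact hw.trans (weight_le_weight h)

theorem monotoneBool_update_threshold {n k : ℕ} {v : Fin n → Bool}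
    (hv : weight v = k ∨ weight v = k + 1) :
    MonotoneBool (Function.update (fun u : Fin n → Bool => decide (k + 1 ≤ weight u)) v
      (!decide (k + 1 ≤ weight v))) := by
  intro x y h hy
  have hle := weight_le_weight h
  have heq := eq_of_weight_le h
  simp only [Function.update_apply] at hy ⊢
  grind

/-- Lower bound in Hansel's theorem: every correct strategy uses at least
`C(n, ⌊n/2⌋) + C(n, ⌊n/2⌋ + 1)` queries on some monotone Boolean function. -/
theorem hansel_lower_bound (n : ℕ) :
    ∀ s : Strategy n, s.Correct →
      ∃ f : (Fin n → Bool) → Bool, MonotoneBool f ∧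
        n.choose (n / 2) + n.choose (n / 2 + 1) ≤ (s.run f).2 := by
  intro s hs
  have hf := monotoneBool_threshold n (n / 2 + 1)
  refine ⟨_, hf, le_trans ?_ (s.card_queried_le _)⟩
  rw [choose_eq_card_weight, choose_eq_card_weight, ← Finset.card_union_of_disjoint]
  · refine Finset.card_le_card fun v hv => hs.mem_queried hf ?_
    exact monotoneBool_update_threshold (by simpa using hv)
  · rw [Finset.disjoint_filter]
    omega
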